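/- The maximal cardinality of an MSTD subset of {0, 1, ..., 16} is 10; that is, there exists an MSTD subset of {0, ..., 16} of cardinality 10, and every MSTD subset of {0, ..., 16} has cardinality at most 10. -/

import Mathlib

open Pointwise

def pc : ℕ → ℕ → ℕ :=
  fun k => Nat.rec (fun _ => 0) (fun _ ih n => Nat.add (Nat.mod n 2) (ih (Nat.div n 2))) k

def leaf (S D : ℕ) : Bool :=
  Bool.rec (Nat.ble (Nat.succ (pc 33 S)) (Nat.mul 2 (pc 17 D))) true (Nat.beq D 131071)

def chk : ℕ → ℕ → ℕ → ℕ → ℕ → ℕ → ℕ → Bool :=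
  fun n => Nat.rec (fun _ _ _ S D _ => leaf S D)
   (fun _ ih i k A S D R =>
    Bool.rec false
     (Nat.rec true (fun k _ => ih (Nat.succ i) k A S D (Nat.mul 2 R)) k)
     (ih (Nat.succ i) k (Nat.lor A (Nat.shiftLeft 1 i))
       (Nat.lor S (Nat.shiftLeft (Nat.lor A (Nat.shiftLeft 1 i)) i))
       (Nat.lor D (Nat.succ (Nat.mul 2 R))) (Nat.succ (Nat.mul 2 R)))) n

theorem chk_ok : chk 17 0 6 0 0 0 0 = true := by decide +kernel

theorem pc_succ (k n : ℕ) : pc (k+1) n = n % 2 + pc k (n / 2) := rfl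

theorem pc_eq (k : ℕ) : ∀ n, pc k n = ((Finset.range k).filter (fun j => n.testBit j = true)).card := by
  induction k with
  | zero => intro n; rfl
  | succ k ih =>
    intro n
    rw [pc_succ, ih, Finset.card_filter, Finset.card_filter, Finset.sum_range_succ', add_comm]
    congr 1
    · simp only [Nat.testBit_succ]
    · rw [Nat.testBit_zero]
      rcases Nat.mod_two_eq_zero_or_one n with h | h <;> simp [h]

theorem leaf_spec (S D : ℕ) (h : leaf S D = true) : pc 33 S + 1 ≤ 2 * pc 17 D := by
  unfold leaf at h
  cases hb : Nat.beq D 131071 with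
  | false => rw [hb] at h; exact Nat.le_of_ble_eq_true h
  | true =>
    have := Nat.eq_of_beq_eq_true hb
    subst this
    have h1 : pc 17 131071 = 17 := rfl
    have h2 : pc 33 S ≤ 33 := by
      rw [pc_eq]
      exact (Finset.card_filter_le _ _).trans (by simp)
    omega

theorem chk_succ (n i k A S D R : ℕ) (h : chk (n+1) i k A S D R = true) :
    chk n (i+1) k (A ||| 1 <<< i) (S ||| ((A ||| 1 <<< i) <<< i)) (D ||| (2*R+1)) (2*R+1) = true ∧
    ∀ k', k = k' + 1 → chk n (i+1) k' A S D (2*R) = true := by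
  change (Bool.rec false
     (Nat.rec true (fun k _ => chk n (Nat.succ i) k A S D (Nat.mul 2 R)) k)
     (chk n (i+1) k (A ||| 1 <<< i) (S ||| ((A ||| 1 <<< i) <<< i)) (D ||| (2*R+1)) (2*R+1)) : Bool)
      = true at h
  cases hb : chk n (i+1) k (A ||| 1 <<< i) (S ||| ((A ||| 1 <<< i) <<< i)) (D ||| (2*R+1)) (2*R+1) with
  | false => rw [hb] at h; exact absurd h (by simp)
  | true =>
    rw [hb] at h
    refine ⟨rfl, ?_⟩
    rintro k' rfl
    exact h

theorem tb_odd (R r : ℕ) : (2*R+1).testBit r = true ↔ r = 0 ∨ ∃ r', r = r'+1 ∧ R.testBit r' = true := by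
  cases r with
  | zero => simp
  | succ r => simp [Nat.testBit_succ, show (2*R+1)/2 = R by omega]

theorem tb_even (R r : ℕ) : (2*R).testBit r = true ↔ ∃ r', r = r'+1 ∧ R.testBit r' = true := by
  cases r with
  | zero => simp
  | succ r => simp [Nat.testBit_succ]

theorem tb_one (i j : ℕ) : (1 <<< i).testBit j = true ↔ j = i := by
  rw [Nat.one_shiftLeft, Nat.testBit_two_pow]; simp [eq_comm]

theorem chk_sound (T : ℕ → Prop) [DecidablePred T] (n : ℕ) : ∀ i k A S D R, i + n = 17 →
    chk n i k A S D R = true →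
    (∀ a, A.testBit a = true ↔ a < i ∧ T a) →
    (∀ s, S.testBit s = true ↔ ∃ a b, a < i ∧ b < i ∧ T a ∧ T b ∧ a + b = s) →
    (∀ d, D.testBit d = true ↔ ∃ a b, a < i ∧ b < i ∧ T a ∧ T b ∧ a = b + d) →
    (∀ r, R.testBit r = true ↔ ∃ a, a < i ∧ T a ∧ a + r + 1 = i) →
    ((Finset.Ico i 17).filter (fun j => ¬ T j)).card ≤ k →
    ∃ S D, pc 33 S + 1 ≤ 2 * pc 17 D ∧
      (∀ s, S.testBit s = true ↔ ∃ a b, a < 17 ∧ b < 17 ∧ T a ∧ T b ∧ a + b = s) ∧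
      (∀ d, D.testBit d = true ↔ ∃ a b, a < 17 ∧ b < 17 ∧ T a ∧ T b ∧ a = b + d) := by
  induction n with
  | zero =>
    intro i k A S D R hi h hA hS hD hR hk
    obtain rfl : i = 17 := by omega
    exact ⟨S, D, leaf_spec S D h, hS, hD⟩
  | succ n ih =>
    intro i k A S D R hi h hA hS hD hR hk
    obtain ⟨h1, h2⟩ := chk_succ n i k A S D R h
    have hI : Finset.Ico i 17 = insert i (Finset.Ico (i+1) 17) := by
      ext x; simp only [Finset.mem_insert, Finset.mem_Ico]; omega
    by_cases hT : T i
    · have hA' : ∀ a, (A ||| 1 <<< i).testBit a = true ↔ a < i + 1 ∧ T a := by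
        intro a
        rw [Nat.testBit_or, Bool.or_eq_true, hA, tb_one]
        constructor
        · rintro (⟨h, h'⟩ | rfl)
          · exact ⟨by omega, h'⟩
          · exact ⟨by omega, hT⟩
        · rintro ⟨h, h'⟩
          by_cases e : a = i
          · exact Or.inr e
          · exact Or.inl ⟨by omega, h'⟩
      have hR' : ∀ r, (2*R+1).testBit r = true ↔ ∃ a, a < i+1 ∧ T a ∧ a + r + 1 = i+1 := by
        intro r
        rw [tb_odd]
        constructor
        · rintro (rfl | ⟨r', rfl, h⟩)
          · exact ⟨i, by omega, hT, by omega⟩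
          · obtain ⟨a, ha, hTa, e⟩ := (hR r').1 h
            exact ⟨a, by omega, hTa, by omega⟩
        · rintro ⟨a, ha, hTa, e⟩
          cases r with
          | zero => exact Or.inl rfl
          | succ r => exact Or.inr ⟨r, rfl, (hR r).2 ⟨a, by omega, hTa, by omega⟩⟩
      refine ih _ _ _ _ _ _ (by omega) h1 hA' ?_ ?_ hR' ?_
      · intro s
        rw [Nat.testBit_or, Bool.or_eq_true, hS, Nat.testBit_shiftLeft, Bool.and_eq_true, hA']
        simp only [decide_eq_true_eq]
        constructor
        · rintro (⟨a, b, ha, hb, hTa, hTb, e⟩ | ⟨h, h', h''⟩)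
          · exact ⟨a, b, by omega, by omega, hTa, hTb, e⟩
          · exact ⟨s - i, i, by omega, by omega, h'', hT, by omega⟩
        · rintro ⟨a, b, ha, hb, hTa, hTb, e⟩
          by_cases e1 : a = i
          · right
            have : s - i = b := by omega
            rw [this]
            exact ⟨by omega, hb, hTb⟩
          · by_cases e2 : b = i
            · right
              have : s - i = a := by omega
              rw [this]
              exact ⟨by omega, ha, hTa⟩
            · exact Or.inl ⟨a, b, by omega, by omega, hTa, hTb, e⟩
      · intro d
        rw [Nat.testBit_or, Bool.or_eq_true, hD, hR']
        constructor
        · rintro (⟨a, b, ha, hb, hTa, hTb, e⟩ | ⟨a, ha, hTa, e⟩)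
          · exact ⟨a, b, by omega, by omega, hTa, hTb, e⟩
          · exact ⟨i, a, by omega, by omega, hT, hTa, by omega⟩
        · rintro ⟨a, b, ha, hb, hTa, hTb, e⟩
          by_cases e1 : a = i
          · exact Or.inr ⟨b, hb, hTb, by omega⟩
          · exact Or.inl ⟨a, b, by omega, by omega, hTa, hTb, e⟩
      · rw [hI, Finset.filter_insert, if_neg (by simpa using hT)] at hk
        exact hk
    · rw [hI, Finset.filter_insert, if_pos hT, Finset.card_insert_of_notMem (by simp)] at hk
      have key : ∀ a, a < i + 1 → T a → a < i := by
        intro a ha hTa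
        by_contra hc
        obtain rfl : a = i := by omega
        exact hT hTa
      refine ih _ (k-1) _ _ _ _ (by omega) (h2 (k-1) (by omega)) ?_ ?_ ?_ ?_ (by omega)
      · intro a
        rw [hA]
        exact ⟨fun ⟨h, h'⟩ => ⟨by omega, h'⟩, fun ⟨h, h'⟩ => ⟨key a h h', h'⟩⟩
      · intro s
        rw [hS]
        exact ⟨fun ⟨a, b, ha, hb, hTa, hTb, e⟩ => ⟨a, b, by omega, by omega, hTa, hTb, e⟩,
          fun ⟨a, b, ha, hb, hTa, hTb, e⟩ => ⟨a, b, key a ha hTa, key b hb hTb, hTa, hTb, e⟩⟩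
      · intro s
        rw [hD]
        exact ⟨fun ⟨a, b, ha, hb, hTa, hTb, e⟩ => ⟨a, b, by omega, by omega, hTa, hTb, e⟩,
          fun ⟨a, b, ha, hb, hTa, hTb, e⟩ => ⟨a, b, key a ha hTa, key b hb hTb, hTa, hTb, e⟩⟩
      · intro r
        rw [tb_even]
        constructor
        · rintro ⟨r', rfl, h⟩
          obtain ⟨a, ha, hTa, e⟩ := (hR r').1 h
          exact ⟨a, by omega, hTa, by omega⟩
        · rintro ⟨a, ha, hTa, e⟩
          have := key a ha hTa
          exact ⟨r - 1, by omega, (hR _).2 ⟨a, this, hTa, by omega⟩⟩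

theorem upper (A : Finset ℤ) (hA : A ⊆ Finset.Icc 0 16) (h : (A + A).card > (A - A).card) :
    A.card ≤ 10 := by
  by_contra hc
  have hmem : ∀ x ∈ A, ∃ a : ℕ, a < 17 ∧ (a : ℤ) = x := by
    intro x hx
    have := Finset.mem_Icc.1 (hA hx)
    exact ⟨x.toNat, by omega, by omega⟩
  have hcard : ((Finset.Ico 0 17).filter (fun j : ℕ => ¬ (j : ℤ) ∈ A)).card ≤ 6 := by
    have h1 := Finset.card_filter_add_card_filter_not (s := Finset.Ico 0 17) (fun j : ℕ => (j : ℤ) ∈ A)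
    have h2 : A.card ≤ ((Finset.Ico 0 17).filter (fun j : ℕ => (j : ℤ) ∈ A)).card := by
      refine le_trans (Finset.card_le_card ?_)
        (Finset.card_image_le (f := fun j : ℕ => (j : ℤ)))
      intro x hx
      obtain ⟨a, ha, rfl⟩ := hmem x hx
      exact Finset.mem_image.2 ⟨a, by simp [ha, hx], rfl⟩
    simp only [Nat.card_Ico] at h1
    omega
  obtain ⟨S, D, hSD, hS, hD⟩ := chk_sound (fun j : ℕ => (j : ℤ) ∈ A) 17 0 6 0 0 0 0 rfl chk_ok
    (by simp) (by simp) (by simp) (by simp) hcard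
  rw [pc_eq, pc_eq] at hSD
  have hs : (A + A).card ≤ ((Finset.range 33).filter (fun j => S.testBit j = true)).card := by
    refine le_trans (Finset.card_le_card ?_)
      (Finset.card_image_le (f := fun j : ℕ => (j : ℤ)))
    intro x hx
    obtain ⟨y, hy, z, hz, rfl⟩ := Finset.mem_add.1 hx
    obtain ⟨a, ha, rfl⟩ := hmem y hy
    obtain ⟨b, hb, rfl⟩ := hmem z hz
    refine Finset.mem_image.2 ⟨a + b, Finset.mem_filter.2 ⟨Finset.mem_range.2 (by omega), ?_⟩, by simp⟩
    exact (hS _).2 ⟨a, b, ha, hb, hy, hz, rfl⟩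
  set E := (Finset.range 17).filter (fun j => D.testBit j = true) with hE
  have hEm : ∀ d ∈ E, (d : ℤ) ∈ A - A ∧ -(d : ℤ) ∈ A - A := by
    intro d hd
    obtain ⟨a, b, ha, hb, hTa, hTb, e⟩ := (hD d).1 (Finset.mem_filter.1 hd).2
    exact ⟨Finset.mem_sub.2 ⟨a, hTa, b, hTb, by omega⟩, Finset.mem_sub.2 ⟨b, hTb, a, hTa, by omega⟩⟩
  have hd : E.card + (E.erase 0).card ≤ (A - A).card := by
    rw [← Finset.card_image_of_injective E (f := fun j : ℕ => (j : ℤ)) (by intro a b; simp),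
      ← Finset.card_image_of_injective (E.erase 0) (f := fun j : ℕ => -(j : ℤ)) (by intro a b; simp),
      ← Finset.card_union_of_disjoint]
    · apply Finset.card_le_card
      intro x hx
      rcases Finset.mem_union.1 hx with hx | hx
      · obtain ⟨d, hd, rfl⟩ := Finset.mem_image.1 hx
        exact (hEm d hd).1
      · obtain ⟨d, hd, rfl⟩ := Finset.mem_image.1 hx
        exact (hEm d (Finset.mem_of_mem_erase hd)).2
    · rw [Finset.disjoint_left]
      intro x hx hx'
      obtain ⟨d, hd, rfl⟩ := Finset.mem_image.1 hx
      obtain ⟨d', hd', e⟩ := Finset.mem_image.1 hx'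
      have := Finset.ne_of_mem_erase hd'
      omega
  have := Finset.pred_card_le_card_erase (s := E) (a := 0)
  omega

theorem stmt_17 :
    (∃ A : Finset ℤ, A ⊆ Finset.Icc 0 16 ∧ (A + A).card > (A - A).card ∧ A.card = 10) ∧
      (∀ A : Finset ℤ, A ⊆ Finset.Icc 0 16 → (A + A).card > (A - A).card → A.card ≤ 10) := by
  refine ⟨⟨{0, 1, 2, 5, 7, 8, 9, 13, 14, 16}, ?_, ?_, ?_⟩, upper⟩
  · decide +kernel
  · decide +kernel
  · decide +kernel
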